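/- arXiv:2210.02031 — 2 statements merged into one kernel-verified Lean document; each statement's English description precedes it below -/
import Mathlib

section
/- Let P and Q be disjoint finite posets and let k be a field. Then there are k-algebra isomorphisms k[P ⊕ Q] ≅ k[Q ⊕ P] ≅ k[P] ⊗_k k[Q], where k[−] denotes the Hibi ring and ⊕ the ordinal sum. -/
open scoped TensorProduct

set_option synthInstance.maxHeartbeats 400000
set_option maxHeartbeats 800000

/-- The generator of the Hibi ring attached to a poset ideal `I`:
the monomial `t₀ · ∏_{p ∈ I} t_p` in `k[t₀, (t_p)_{p ∈ P}]`. -/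
noncomputable def hibiGen (k : Type*) [Field k] {P : Type*} (I : Finset P) :
    MvPolynomial (Option P) k :=
  MvPolynomial.X none * ∏ p ∈ I, MvPolynomial.X (some p)

/-- The Hibi ring of a finite poset `P` over a field `k`: the subalgebra of the
polynomial ring `k[t₀, (t_p)_{p ∈ P}]` generated by the monomials
`t₀ · ∏_{p ∈ I} t_p`, where `I` runs over the poset ideals of `P`. -/
noncomputable def hibiRing (k : Type*) [Field k] (P : Type*) [PartialOrder P] :
    Subalgebra k (MvPolynomial (Option P) k) :=
  Algebra.adjoin k
    {f | ∃ I : Finset P, (∀ p ∈ I, ∀ q, q ≤ p → q ∈ I) ∧ f = hibiGen k I}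

instance {α β : Type*} [Fintype α] [Fintype β] : Fintype (α ⊕ₗ β) :=
  inferInstanceAs (Fintype (α ⊕ β))

universe w

/-- The finset of `P ⊕ₗ PUnit ⊕ₗ Q` whose three components are `s`, `u` and `t`. -/
def ordinalSumFinset {P Q : Type*} (s : Finset P) (u : Finset PUnit) (t : Finset Q) :
    Finset (P ⊕ₗ PUnit ⊕ₗ Q) :=
  (s.disjSum ((u.disjSum t).map toLex.toEmbedding)).map toLex.toEmbedding

theorem hibiGen_ordinalSumFinset (k : Type*) [Field k] {P Q : Type*}
    (s : Finset P) (u : Finset PUnit) (t : Finset Q) :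
    hibiGen k (ordinalSumFinset s u t) =
      MvPolynomial.X none * ((∏ p ∈ s, MvPolynomial.X (some (toLex (Sum.inl p)))) *
        ((∏ z ∈ u, MvPolynomial.X (some (toLex (Sum.inr (toLex (Sum.inl z)))))) *
          ∏ q ∈ t, MvPolynomial.X (some (toLex (Sum.inr (toLex (Sum.inr q))))))) := by
  simp [hibiGen, ordinalSumFinset, Finset.prod_map, Finset.prod_disjSum]

theorem exists_eq_ordinalSumFinset {P Q : Type*} (I : Finset (P ⊕ₗ PUnit ⊕ₗ Q)) :
    ∃ s u t, I = ordinalSumFinset s u t := by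
  let J := (I.map ofLex.toEmbedding).toRight.map ofLex.toEmbedding
  refine ⟨(I.map ofLex.toEmbedding).toLeft, J.toLeft, J.toRight, ?_⟩
  ext x
  obtain ⟨x, rfl⟩ := toLex.surjective x
  rcases x with p | x
  · simp [ordinalSumFinset]
  · obtain ⟨x, rfl⟩ := toLex.surjective x
    rcases x with z | q <;> simp [ordinalSumFinset, J]

@[simp]
theorem inl_mem_ordinalSumFinset {P Q : Type*} {s : Finset P} {u : Finset PUnit} {t : Finset Q}
    {p : P} : toLex (Sum.inl p) ∈ ordinalSumFinset s u t ↔ p ∈ s := by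
  simp [ordinalSumFinset]

@[simp]
theorem inr_inl_mem_ordinalSumFinset {P Q : Type*} {s : Finset P} {u : Finset PUnit}
    {t : Finset Q} {z : PUnit} :
    toLex (Sum.inr (toLex (Sum.inl z))) ∈ ordinalSumFinset s u t ↔ z ∈ u := by
  simp [ordinalSumFinset]

@[simp]
theorem inr_inr_mem_ordinalSumFinset {P Q : Type*} {s : Finset P} {u : Finset PUnit}
    {t : Finset Q} {q : Q} :
    toLex (Sum.inr (toLex (Sum.inr q))) ∈ ordinalSumFinset s u t ↔ q ∈ t := by
  simp [ordinalSumFinset]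

theorem isLowerSet_ordinalSumFinset_iff {P Q : Type*} [PartialOrder P] [PartialOrder Q]
    [Fintype P] (s : Finset P) (u : Finset PUnit) (t : Finset Q) :
    (∀ x ∈ ordinalSumFinset s u t, ∀ y, y ≤ x → y ∈ ordinalSumFinset s u t) ↔
      ((∀ p ∈ s, ∀ q, q ≤ p → q ∈ s) ∧ u = ∅ ∧ t = ∅) ∨
      (s = Finset.univ ∧ u = Finset.univ ∧ ∀ p ∈ t, ∀ q, q ≤ p → q ∈ t) := by
  simp only [Lex.forall, Sum.forall, inl_mem_ordinalSumFinset, inr_inl_mem_ordinalSumFinset,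
    inr_inr_mem_ordinalSumFinset, Sum.Lex.inl_le_inl_iff, Sum.Lex.inr_le_inr_iff,
    Sum.Lex.inl_le_inr, Sum.Lex.not_inr_le_inl, Finset.ext_iff, Finset.mem_univ,
    Finset.notMem_empty]
  grind

/-- The embedding of `k[t₀, (t_p)_{p ∈ P}]` onto the variables of the lower summand. -/
noncomputable def hibiLower (k : Type*) [Field k] (P Q : Type*) :
    MvPolynomial (Option P) k →ₐ[k] MvPolynomial (Option (P ⊕ₗ PUnit ⊕ₗ Q)) k :=
  MvPolynomial.rename (Option.map (toLex ∘ Sum.inl))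

/-- The homomorphism from `k[t₀, (t_q)_{q ∈ Q}]` that fixes the variables of the upper summand
and sends `t₀` to the generator of the ideal of all elements not in the upper summand. -/
noncomputable def hibiUpper (k : Type*) [Field k] (P Q : Type*) [Fintype P] :
    MvPolynomial (Option Q) k →ₐ[k] MvPolynomial (Option (P ⊕ₗ PUnit ⊕ₗ Q)) k :=
  MvPolynomial.aeval fun o => o.elim (hibiGen k (ordinalSumFinset Finset.univ Finset.univ ∅))
    fun q => MvPolynomial.X (some (toLex (Sum.inr (toLex (Sum.inr q)))))

theorem hibiLower_hibiGen (k : Type*) [Field k] {P Q : Type*} (s : Finset P) :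
    hibiLower k P Q (hibiGen k s) = hibiGen k (ordinalSumFinset s ∅ ∅) := by
  rw [hibiGen_ordinalSumFinset]
  simp [hibiGen, hibiLower]

theorem hibiUpper_hibiGen (k : Type*) [Field k] {P Q : Type*} [Fintype P] (t : Finset Q) :
    hibiUpper k P Q (hibiGen k t) =
      hibiGen k (ordinalSumFinset Finset.univ Finset.univ t) := by
  rw [hibiGen_ordinalSumFinset]
  rw [hibiGen, map_mul, hibiUpper, MvPolynomial.aeval_X, Option.elim_none,
    hibiGen_ordinalSumFinset]
  simp [mul_assoc]

theorem map_hibiLower_sup_map_hibiUpper (k : Type*) [Field k] (P Q : Type*)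
    [PartialOrder P] [PartialOrder Q] [Fintype P] :
    (hibiRing k P).map (hibiLower k P Q) ⊔ (hibiRing k Q).map (hibiUpper k P Q) =
      hibiRing k (P ⊕ₗ PUnit ⊕ₗ Q) := by
  simp only [hibiRing]
  rw [AlgHom.map_adjoin, AlgHom.map_adjoin, ← Algebra.adjoin_union]
  congr 1
  ext f
  constructor
  · rintro (⟨_, ⟨s, hs, rfl⟩, rfl⟩ | ⟨_, ⟨t, ht, rfl⟩, rfl⟩)
    · exact ⟨ordinalSumFinset s ∅ ∅,
        (isLowerSet_ordinalSumFinset_iff _ _ _).2 (.inl ⟨hs, rfl, rfl⟩), hibiLower_hibiGen k s⟩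
    · exact ⟨ordinalSumFinset Finset.univ Finset.univ t,
        (isLowerSet_ordinalSumFinset_iff _ _ _).2 (.inr ⟨rfl, rfl, ht⟩), hibiUpper_hibiGen k t⟩
  · rintro ⟨I, hI, rfl⟩
    obtain ⟨s, u, t, rfl⟩ := exists_eq_ordinalSumFinset I
    obtain ⟨hs, rfl, rfl⟩ | ⟨rfl, rfl, ht⟩ := (isLowerSet_ordinalSumFinset_iff _ _ _).1 hI
    · exact .inl ⟨_, ⟨s, hs, rfl⟩, hibiLower_hibiGen k s⟩
    · exact .inr ⟨_, ⟨t, ht, rfl⟩, hibiUpper_hibiGen k t⟩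

theorem productMap_hibiLower_hibiUpper_injective (k : Type*) [Field k] (P Q : Type*)
    [Fintype P] :
    Function.Injective
      (Algebra.TensorProduct.productMap (hibiLower.{_, _, _, w} k P Q) (hibiUpper k P Q)) := by
  let R := MvPolynomial (Option P ⊕ Option Q) k
  let K := FractionRing R
  let x : Option P ⊕ Option Q → K := fun i => algebraMap R K (MvPolynomial.X i)
  have hx : ∀ i, x i ≠ 0 := fun i =>
    (map_ne_zero_iff _ (IsFractionRing.injective R K)).2 (MvPolynomial.X_ne_zero i)
  let ψ : MvPolynomial (Option (P ⊕ₗ PUnit.{w + 1} ⊕ₗ Q)) k →ₐ[k] K :=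
    MvPolynomial.aeval fun o => o.elim (x (Sum.inl none)) fun l =>
      Sum.elim (fun p => x (Sum.inl (some p)))
        (fun m => Sum.elim
          (fun _ => x (Sum.inr none) / (x (Sum.inl none) * ∏ p, x (Sum.inl (some p))))
          (fun q => x (Sum.inr (some q))) (ofLex m)) (ofLex l)
  have hψ : ψ.comp (Algebra.TensorProduct.productMap (hibiLower k P Q) (hibiUpper k P Q)) =
      (IsScalarTower.toAlgHom k R K).comp
        (MvPolynomial.tensorEquivSum k (Option P) (Option Q) k).toAlgHom := by
    ext i
    · rcases i with _ | p <;> simp [ψ, hibiLower, x]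
    · rcases i with _ | q
      · have hprod : ∏ p, x (Sum.inl (some p)) ≠ 0 := Finset.prod_ne_zero_iff.2 fun p _ => hx _
        have h0 := hx (Sum.inl none)
        simp [ψ, hibiUpper, hibiGen_ordinalSumFinset k Finset.univ]
        rw [← mul_assoc]
        exact mul_div_cancel₀ _ (mul_ne_zero h0 hprod)
      · simp [ψ, hibiUpper, x]
  have hinj : Function.Injective
      ((IsScalarTower.toAlgHom k R K).comp
        (MvPolynomial.tensorEquivSum k (Option P) (Option Q) k).toAlgHom) :=
    (IsFractionRing.injective R K).comp (AlgEquiv.injective _)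
  rw [← hψ, AlgHom.coe_comp] at hinj
  exact Function.Injective.of_comp hinj

/-- The Hibi ring of an ordinal sum is the tensor product of the Hibi rings. -/
theorem nonempty_hibiRing_ordinalSum_algEquiv (k : Type*) [Field k] (P Q : Type*)
    [PartialOrder P] [PartialOrder Q] [Fintype P] :
    Nonempty ((hibiRing k (P ⊕ₗ PUnit ⊕ₗ Q)) ≃ₐ[k] ((hibiRing k P) ⊗[k] (hibiRing k Q))) := by
  let f := Algebra.TensorProduct.productMap ((hibiLower k P Q).comp (hibiRing k P).val)
    ((hibiUpper k P Q).comp (hibiRing k Q).val)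
  have hf : f = (Algebra.TensorProduct.productMap (hibiLower k P Q) (hibiUpper k P Q)).comp
      (Algebra.TensorProduct.map (hibiRing k P).val (hibiRing k Q).val) := by
    ext <;> simp [f]
  have hinj : Function.Injective f := by
    rw [hf]
    exact (productMap_hibiLower_hibiUpper_injective k P Q).comp
      (TensorProduct.map_injective_of_flat_flat _ _ Subtype.val_injective Subtype.val_injective)
  have hrange : f.range = hibiRing k (P ⊕ₗ PUnit ⊕ₗ Q) := by
    rw [Algebra.TensorProduct.productMap_range, AlgHom.range_comp, AlgHom.range_comp,
      Subalgebra.range_val, Subalgebra.range_val, map_hibiLower_sup_map_hibiUpper]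
  exact ⟨((AlgEquiv.ofInjective f hinj).trans (Subalgebra.equivOfEq _ _ hrange)).symm⟩

/-- For disjoint finite posets `P` and `Q` (ordinal sum realized as
`P ⊕ₗ PUnit ⊕ₗ Q`, the new element being the middle `PUnit`), there are `k`-algebra
isomorphisms `k[P ⊕ Q] ≅ k[Q ⊕ P] ≅ k[P] ⊗[k] k[Q]`. -/
theorem hibi_ordinal_sum_tensor
    (k : Type*) [Field k] (P Q : Type*) [PartialOrder P] [PartialOrder Q]
    [Fintype P] [Fintype Q] :
    Nonempty ((hibiRing k (P ⊕ₗ PUnit ⊕ₗ Q)) ≃ₐ[k] (hibiRing k (Q ⊕ₗ PUnit ⊕ₗ P))) ∧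
    Nonempty ((hibiRing k (P ⊕ₗ PUnit ⊕ₗ Q)) ≃ₐ[k]
      ((hibiRing k P) ⊗[k] (hibiRing k Q))) := by
  obtain ⟨e⟩ := nonempty_hibiRing_ordinalSum_algEquiv k P Q
  obtain ⟨e'⟩ := nonempty_hibiRing_ordinalSum_algEquiv k Q P
  exact ⟨⟨(e.trans (Algebra.TensorProduct.comm k _ _)).trans e'.symm⟩,
    nonempty_hibiRing_ordinalSum_algEquiv k P Q⟩
end

section
/- Let P and Q be disjoint finite posets and let k be a field. Then the Hibi ring k[P + Q] of the disjoint union P + Q is isomorphic, as a graded k-algebra, to the Segre product of k[P] and k[Q] (with respect to the standard gradings in which the monomial generators have degree 1, i.e. grading by the exponent of t_0). -/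
open scoped TensorProduct

set_option synthInstance.maxHeartbeats 400000
set_option maxHeartbeats 800000

/-- The standard grading of the Hibi ring: the variable `t₀` has weight `1` and all the
other variables have weight `0`, so that the degree of a monomial is its `t₀`-exponent. -/
def t0Weight (P : Type*) : Option P → ℕ := fun o => o.elim 1 fun _ => 0

/-- The `m`-th graded piece `R_m ⊗_k S_m` of the Segre product of the Hibi rings
`R = k[P]` and `S = k[Q]`, as a `k`-submodule of
`k[t₀,(t_p)] ⊗[k] k[t₀,(t_q)]`. -/
noncomputable def segrePiece (k : Type*) [Field k] (P Q : Type*) [PartialOrder P]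
    [PartialOrder Q] (m : ℕ) :
    Submodule k (MvPolynomial (Option P) k ⊗[k] MvPolynomial (Option Q) k) :=
  Submodule.span k
    {t | ∃ f g, f ∈ hibiRing k P ∧ g ∈ hibiRing k Q ∧
      MvPolynomial.IsWeightedHomogeneous (t0Weight P) f m ∧
      MvPolynomial.IsWeightedHomogeneous (t0Weight Q) g m ∧ t = f ⊗ₜ[k] g}

/-- The degree-one generators of the Hibi ring. -/
def hibiGenerators (k : Type*) [Field k] (P : Type*) [PartialOrder P] :
    Set (MvPolynomial (Option P) k) :=
  {f | ∃ I : Finset P, (∀ p ∈ I, ∀ q, q ≤ p → q ∈ I) ∧ f = hibiGen k I}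

lemma isWeightedHomogeneous_hibiGen (k : Type*) [Field k] {P : Type*} (I : Finset P) :
    MvPolynomial.IsWeightedHomogeneous (t0Weight P) (hibiGen k I) 1 := by
  have h := MvPolynomial.IsWeightedHomogeneous.prod I
    (fun p => (MvPolynomial.X (some p) : MvPolynomial (Option P) k)) (fun _ => 0)
    (w := t0Weight P) (fun p _ => MvPolynomial.isWeightedHomogeneous_X k _ _)
  have h' := (MvPolynomial.isWeightedHomogeneous_X k (t0Weight P) none).mul h
  simpa [t0Weight, hibiGen] using h'

lemma isWeightedHomogeneous_of_mem_span_hibiGenerators_pow {k : Type*} [Field k] {P : Type*}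
    [PartialOrder P] {m : ℕ} {f : MvPolynomial (Option P) k}
    (hf : f ∈ Submodule.span k (hibiGenerators k P) ^ m) :
    MvPolynomial.IsWeightedHomogeneous (t0Weight P) f m := by
  suffices h : Submodule.span k (hibiGenerators k P) ^ m ≤
      MvPolynomial.weightedHomogeneousSubmodule k (t0Weight P) m from h hf
  clear hf
  induction m with
  | zero =>
    rw [pow_zero, Submodule.one_le]
    exact MvPolynomial.isWeightedHomogeneous_one k _
  | succ m ih =>
    rw [pow_succ]
    refine (mul_le_mul' ih (Submodule.span_le.2 ?_)).trans
      (MvPolynomial.weightedHomogeneousSubmodule_mul _ m 1)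
    rintro _ ⟨I, -, rfl⟩
    exact isWeightedHomogeneous_hibiGen k I

lemma Algebra.toSubmodule_adjoin_eq_iSup_span_pow {R A : Type*} [CommSemiring R] [Semiring A]
    [Algebra R A] (s : Set A) :
    Subalgebra.toSubmodule (Algebra.adjoin R s) = ⨆ m : ℕ, Submodule.span R s ^ m := by
  apply le_antisymm
  · rw [Algebra.adjoin_eq_span, Submodule.span_le]
    intro x hx
    obtain ⟨m, hm⟩ : ∃ m : ℕ, x ∈ Submodule.span R s ^ m := by
      induction hx using Submonoid.closure_induction with
      | mem x hx => exact ⟨1, by simpa using Submodule.subset_span hx⟩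
      | one => exact ⟨0, by rw [pow_zero]; exact Submodule.one_le.1 le_rfl⟩
      | mul x y _ _ hx hy =>
        obtain ⟨a, ha⟩ := hx
        obtain ⟨b, hb⟩ := hy
        exact ⟨a + b, by rw [pow_add]; exact Submodule.mul_mem_mul ha hb⟩
    exact Submodule.mem_iSup_of_mem m hm
  · refine iSup_le fun m => ?_
    induction m with
    | zero => simp [Submodule.one_le, one_mem]
    | succ m ih =>
      rw [pow_succ, Submodule.mul_le]
      exact fun x hx y hy =>
        (Algebra.adjoin R s).mul_mem (ih hx) (Algebra.span_le_adjoin R s hy)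

lemma mem_span_hibiGenerators_pow_iff {k : Type*} [Field k] {P : Type*} [PartialOrder P] {m : ℕ}
    {f : MvPolynomial (Option P) k} :
    f ∈ Submodule.span k (hibiGenerators k P) ^ m ↔
      f ∈ hibiRing k P ∧ MvPolynomial.IsWeightedHomogeneous (t0Weight P) f m := by
  have hsup := Algebra.toSubmodule_adjoin_eq_iSup_span_pow (R := k) (hibiGenerators k P)
  refine ⟨fun hf => ⟨?_, isWeightedHomogeneous_of_mem_span_hibiGenerators_pow hf⟩, ?_⟩
  · change f ∈ Subalgebra.toSubmodule (Algebra.adjoin k (hibiGenerators k P))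
    rw [hsup]
    exact Submodule.mem_iSup_of_mem m hf
  · rintro ⟨hf, hm⟩
    change f ∈ Subalgebra.toSubmodule (Algebra.adjoin k (hibiGenerators k P)) at hf
    rw [hsup] at hf
    suffices h : (⨆ i : ℕ, Submodule.span k (hibiGenerators k P) ^ i) ≤
        (Submodule.span k (hibiGenerators k P) ^ m).comap
          (MvPolynomial.weightedHomogeneousComponent (t0Weight P) m) by
      have := h hf
      rwa [Submodule.mem_comap, hm.weightedHomogeneousComponent_same] at this
    refine iSup_le fun i g hg => ?_
    have hgi := isWeightedHomogeneous_of_mem_span_hibiGenerators_pow hg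
    rw [Submodule.mem_comap]
    by_cases hmi : m = i
    · subst hmi
      rwa [hgi.weightedHomogeneousComponent_same]
    · rw [hgi.weightedHomogeneousComponent_ne m hmi]
      exact zero_mem _

lemma segrePiece_eq_mul (k : Type*) [Field k] (P Q : Type*) [PartialOrder P] [PartialOrder Q]
    (m : ℕ) :
    segrePiece k P Q m =
      ((Submodule.span k (hibiGenerators k P)).map
        (Algebra.TensorProduct.includeLeft : MvPolynomial (Option P) k →ₐ[k]
          MvPolynomial (Option P) k ⊗[k] MvPolynomial (Option Q) k).toLinearMap *
      (Submodule.span k (hibiGenerators k Q)).map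
        (Algebra.TensorProduct.includeRight : MvPolynomial (Option Q) k →ₐ[k]
          MvPolynomial (Option P) k ⊗[k] MvPolynomial (Option Q) k).toLinearMap) ^ m := by
  have hcomm : Commute
      ((Submodule.span k (hibiGenerators k P)).map
        (Algebra.TensorProduct.includeLeft : MvPolynomial (Option P) k →ₐ[k]
          MvPolynomial (Option P) k ⊗[k] MvPolynomial (Option Q) k).toLinearMap)
      ((Submodule.span k (hibiGenerators k Q)).map
        (Algebra.TensorProduct.includeRight : MvPolynomial (Option Q) k →ₐ[k]
          MvPolynomial (Option P) k ⊗[k] MvPolynomial (Option Q) k).toLinearMap) := by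
    refine Submodule.mul_comm_of_commute ?_
    rintro _ ⟨f, -, rfl⟩ _ ⟨g, -, rfl⟩
    simp [Commute, SemiconjBy]
  rw [hcomm.mul_pow, ← Submodule.map_pow, ← Submodule.map_pow]
  apply le_antisymm
  · refine Submodule.span_le.2 ?_
    rintro _ ⟨f, g, hf, hg, hfm, hgm, rfl⟩
    have h := Submodule.mul_mem_mul
      (Submodule.mem_map_of_mem (f := (Algebra.TensorProduct.includeLeft :
        MvPolynomial (Option P) k →ₐ[k]
          MvPolynomial (Option P) k ⊗[k] MvPolynomial (Option Q) k).toLinearMap)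
        (mem_span_hibiGenerators_pow_iff.2 ⟨hf, hfm⟩))
      (Submodule.mem_map_of_mem (f := (Algebra.TensorProduct.includeRight :
        MvPolynomial (Option Q) k →ₐ[k]
          MvPolynomial (Option P) k ⊗[k] MvPolynomial (Option Q) k).toLinearMap)
        (mem_span_hibiGenerators_pow_iff.2 ⟨hg, hgm⟩))
    simpa using h
  · rw [Submodule.mul_le]
    rintro _ ⟨f, hf, rfl⟩ _ ⟨g, hg, rfl⟩
    obtain ⟨hf, hfm⟩ := mem_span_hibiGenerators_pow_iff.1 hf
    obtain ⟨hg, hgm⟩ := mem_span_hibiGenerators_pow_iff.1 hg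
    exact Submodule.subset_span ⟨f, g, hf, hg, hfm, hgm, by simp⟩

/-- The substitution `t₀ ↦ t₀ ⊗ t₀`, `t_p ↦ t_p ⊗ 1`, `t_q ↦ 1 ⊗ t_q`. -/
noncomputable def segreMap (k : Type*) [Field k] (P Q : Type*) :
    MvPolynomial (Option (P ⊕ Q)) k →ₐ[k]
      MvPolynomial (Option P) k ⊗[k] MvPolynomial (Option Q) k :=
  MvPolynomial.aeval fun o => o.elim (MvPolynomial.X none ⊗ₜ MvPolynomial.X none)
    (Sum.elim (fun p => MvPolynomial.X (some p) ⊗ₜ 1) (fun q => 1 ⊗ₜ MvPolynomial.X (some q)))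

lemma segreMap_injective (k : Type*) [Field k] (P Q : Type*) :
    Function.Injective (segreMap k P Q) := by
  let ψ : MvPolynomial (Option P) k ⊗[k] MvPolynomial (Option Q) k →ₐ[k]
      MvPolynomial (Option (P ⊕ Q)) k :=
    Algebra.TensorProduct.productMap
      (MvPolynomial.aeval fun o => MvPolynomial.X (o.map Sum.inl))
      (MvPolynomial.aeval fun o => o.elim 1 fun q => MvPolynomial.X (some (Sum.inr q)))
  have h : ψ.comp (segreMap k P Q) = AlgHom.id k _ := by
    ext o : 1
    rcases o with _ | p | q <;> simp [ψ, segreMap]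
  exact Function.LeftInverse.injective (g := ψ) fun x => DFunLike.congr_fun h x

lemma segreMap_hibiGen_disjSum (k : Type*) [Field k] {P Q : Type*} (I : Finset P)
    (J : Finset Q) :
    segreMap k P Q (hibiGen k (I.disjSum J)) = hibiGen k I ⊗ₜ hibiGen k J := by
  have hI : ∏ p ∈ I, (MvPolynomial.X (some p) : MvPolynomial (Option P) k) ⊗ₜ[k]
      (1 : MvPolynomial (Option Q) k) = (∏ p ∈ I, MvPolynomial.X (some p)) ⊗ₜ 1 :=
    (map_prod (Algebra.TensorProduct.includeLeft : MvPolynomial (Option P) k →ₐ[k]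
      MvPolynomial (Option P) k ⊗[k] MvPolynomial (Option Q) k) _ I).symm
  have hJ : ∏ q ∈ J, (1 : MvPolynomial (Option P) k) ⊗ₜ[k]
      (MvPolynomial.X (some q) : MvPolynomial (Option Q) k) =
        1 ⊗ₜ (∏ q ∈ J, MvPolynomial.X (some q)) :=
    (map_prod (Algebra.TensorProduct.includeRight : MvPolynomial (Option Q) k →ₐ[k]
      MvPolynomial (Option P) k ⊗[k] MvPolynomial (Option Q) k) _ J).symm
  simp [hibiGen, segreMap, Finset.prod_disjSum, hI, hJ]

lemma segreMap_image_hibiGenerators (k : Type*) [Field k] (P Q : Type*) [PartialOrder P]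
    [PartialOrder Q] :
    segreMap k P Q '' hibiGenerators k (P ⊕ Q) =
      Set.image2 (fun f g => f ⊗ₜ[k] g) (hibiGenerators k P) (hibiGenerators k Q) := by
  ext t
  constructor
  · rintro ⟨_, ⟨K, hK, rfl⟩, rfl⟩
    rw [← Finset.toLeft_disjSum_toRight (u := K), segreMap_hibiGen_disjSum]
    refine ⟨_, ⟨K.toLeft, fun p hp q hq => ?_, rfl⟩, _, ⟨K.toRight, fun p hp q hq => ?_, rfl⟩, rfl⟩
    · exact Finset.mem_toLeft.2 (hK _ (Finset.mem_toLeft.1 hp) _ (Sum.inl_le_inl_iff.2 hq))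
    · exact Finset.mem_toRight.2 (hK _ (Finset.mem_toRight.1 hp) _ (Sum.inr_le_inr_iff.2 hq))
  · rintro ⟨_, ⟨I, hI, rfl⟩, _, ⟨J, hJ, rfl⟩, rfl⟩
    refine ⟨_, ⟨I.disjSum J, ?_, rfl⟩, segreMap_hibiGen_disjSum k I J⟩
    rintro (p | p) hp (q | q) hq
    · simp only [Finset.inl_mem_disjSum, Sum.inl_le_inl_iff] at *
      exact hI p hp q hq
    · simp at hq
    · simp at hq
    · simp only [Finset.inr_mem_disjSum, Sum.inr_le_inr_iff] at *
      exact hJ p hp q hq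

lemma map_segreMap_span_hibiGenerators_pow (k : Type*) [Field k] (P Q : Type*) [PartialOrder P]
    [PartialOrder Q] (m : ℕ) :
    (Submodule.span k (hibiGenerators k (P ⊕ Q)) ^ m).map (segreMap k P Q).toLinearMap =
      segrePiece k P Q m := by
  rw [segrePiece_eq_mul, Submodule.map_pow, Submodule.map_span, Submodule.map_span,
    Submodule.map_span, Submodule.span_mul_span]
  congr 2
  refine (segreMap_image_hibiGenerators k P Q).trans ?_
  rw [← Set.image2_mul, Set.image2_image_left, Set.image2_image_right]
  simp

/-- For disjoint finite posets `P` and `Q` (disjoint union realized as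
the sum order on `P ⊕ Q`), the Hibi ring `k[P + Q]` is isomorphic, as a graded
`k`-algebra, to the Segre product `⨁_m (k[P]_m ⊗_k k[Q]_m)` of `k[P]` and `k[Q]`:
there is an injective `k`-algebra homomorphism from `k[P + Q]` into
`k[t₀,(t_p)] ⊗[k] k[t₀,(t_q)]` whose range is the Segre product and which maps the
`m`-th homogeneous component of `k[P + Q]` onto `k[P]_m ⊗_k k[Q]_m` for every `m`. -/
theorem hibi_disjoint_union_segre
    (k : Type*) [Field k] (P Q : Type*) [PartialOrder P] [PartialOrder Q]
    [Fintype P] [Fintype Q] :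
    ∃ Φ : (hibiRing k (P ⊕ Q)) →ₐ[k]
        (MvPolynomial (Option P) k ⊗[k] MvPolynomial (Option Q) k),
      Function.Injective Φ ∧
      Set.range Φ = ↑(⨆ m : ℕ, segrePiece k P Q m) ∧
      ∀ m : ℕ, Φ '' {x : hibiRing k (P ⊕ Q) |
          MvPolynomial.IsWeightedHomogeneous (t0Weight (P ⊕ Q))
            (x : MvPolynomial (Option (P ⊕ Q)) k) m}
        = ↑(segrePiece k P Q m) := by
  refine ⟨(segreMap k P Q).comp (hibiRing k (P ⊕ Q)).val,
    (segreMap_injective k P Q).comp Subtype.val_injective, ?_, fun m => ?_⟩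
  · have h : (Subalgebra.toSubmodule (hibiRing k (P ⊕ Q))).map (segreMap k P Q).toLinearMap =
        ⨆ m : ℕ, segrePiece k P Q m := by
      simp_rw [← map_segreMap_span_hibiGenerators_pow, ← Submodule.map_iSup]
      exact congrArg _ (Algebra.toSubmodule_adjoin_eq_iSup_span_pow _)
    rw [← h]
    ext t
    simp
  · rw [← map_segreMap_span_hibiGenerators_pow]
    ext t
    simp [mem_span_hibiGenerators_pow_iff, and_assoc, and_left_comm]
end
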